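/- For every real number a > 0, every positive integer k and every x > 0, set A = f_k'(x)·a·coth(a·x) - f_k''(x) (which is strictly positive). Then f_k''(x)·(1 - f_k'(x)·a·tanh(a·x)/A) = f_k''(x)/(k+1) = g_k(x). -/

import Mathlib

/-- The comparison function `f_k(x) = -(k/a)·(cosh(a·x))^(-1/k)`. -/
noncomputable def fcomp (a : ℝ) (k : ℕ) : ℝ → ℝ :=
  fun x => -((k : ℝ) / a) * Real.cosh (a * x) ^ (-(1 : ℝ) / (k : ℝ))

/-- The function `g_k(x) = a·(k+1-cosh(a·x)²)/(k·(k+1)·(cosh(a·x))^((2k+1)/k))`. -/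
noncomputable def gcomp (a : ℝ) (k : ℕ) : ℝ → ℝ :=
  fun x => a * ((k : ℝ) + 1 - Real.cosh (a * x) ^ 2) /
    ((k : ℝ) * ((k : ℝ) + 1) * Real.cosh (a * x) ^ ((2 * (k : ℝ) + 1) / (k : ℝ)))

theorem hasDerivAt_fcomp {a : ℝ} (ha : a ≠ 0) {k : ℕ} (hk : k ≠ 0) (x : ℝ) :
    HasDerivAt (fcomp a k)
      (Real.sinh (a * x) * Real.cosh (a * x) ^ (-(1 : ℝ) / (k : ℝ) - 1)) x := by
  have hk' : (k : ℝ) ≠ 0 := Nat.cast_ne_zero.mpr hk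
  have hcosh : HasDerivAt (fun y => Real.cosh (a * y)) (Real.sinh (a * x) * a) x := by
    simpa using ((hasDerivAt_id x).const_mul a).cosh
  have h := (hcosh.rpow_const (p := -(1 : ℝ) / (k : ℝ))
    (Or.inl (Real.cosh_pos _).ne')).const_mul (-((k : ℝ) / a))
  refine h.congr_deriv ?_
  field_simp

theorem deriv_fcomp {a : ℝ} (ha : a ≠ 0) {k : ℕ} (hk : k ≠ 0) :
    deriv (fcomp a k) =
      fun x => Real.sinh (a * x) * Real.cosh (a * x) ^ (-(1 : ℝ) / (k : ℝ) - 1) :=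
  funext fun x => (hasDerivAt_fcomp ha hk x).deriv

theorem deriv_deriv_fcomp {a : ℝ} (ha : a ≠ 0) {k : ℕ} (hk : k ≠ 0) (x : ℝ) :
    deriv (deriv (fcomp a k)) x =
      a * ((k : ℝ) + 1 - Real.cosh (a * x) ^ 2) / (k : ℝ) *
        Real.cosh (a * x) ^ (-(1 : ℝ) / (k : ℝ) - 1 - 1) := by
  have hk' : (k : ℝ) ≠ 0 := Nat.cast_ne_zero.mpr hk
  have hC := Real.cosh_pos (a * x)
  have hcosh : HasDerivAt (fun y => Real.cosh (a * y)) (Real.sinh (a * x) * a) x := by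
    simpa using ((hasDerivAt_id x).const_mul a).cosh
  have hsinh : HasDerivAt (fun y => Real.sinh (a * y)) (Real.cosh (a * x) * a) x := by
    simpa using ((hasDerivAt_id x).const_mul a).sinh
  have h := hsinh.mul (hcosh.rpow_const (p := -(1 : ℝ) / (k : ℝ) - 1) (Or.inl hC.ne'))
  rw [deriv_fcomp ha hk]
  refine h.deriv.trans ?_
  have hpow : Real.cosh (a * x) ^ (-(1 : ℝ) / (k : ℝ) - 1) =
      Real.cosh (a * x) ^ (-(1 : ℝ) / (k : ℝ) - 1 - 1) * Real.cosh (a * x) := by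
    rw [Real.rpow_sub_one hC.ne' (-(1 : ℝ) / (k : ℝ) - 1), div_mul_cancel₀ _ hC.ne']
  rw [hpow]
  generalize Real.cosh (a * x) ^ (-(1 : ℝ) / (k : ℝ) - 1 - 1) = P
  have hsq := Real.cosh_sq (a * x)
  field_simp
  linear_combination P * (k + 1) * hsq

theorem stmt_7 (a : ℝ) (ha : 0 < a) (k : ℕ) (hk : 0 < k) (x : ℝ) (hx : 0 < x) :
    0 < deriv (fcomp a k) x * (a * (Real.cosh (a * x) / Real.sinh (a * x)))
        - deriv (deriv (fcomp a k)) x ∧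
    deriv (deriv (fcomp a k)) x *
        (1 - deriv (fcomp a k) x * (a * Real.tanh (a * x)) /
          (deriv (fcomp a k) x * (a * (Real.cosh (a * x) / Real.sinh (a * x)))
            - deriv (deriv (fcomp a k)) x))
      = deriv (deriv (fcomp a k)) x / ((k : ℝ) + 1) ∧
    deriv (deriv (fcomp a k)) x / ((k : ℝ) + 1) = gcomp a k x := by
  have hk0 : (0 : ℝ) < k := Nat.cast_pos.mpr hk
  have hC := Real.cosh_pos (a * x)
  have hS : 0 < Real.sinh (a * x) := Real.sinh_pos_iff.mpr (mul_pos ha hx)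
  have hpow : Real.cosh (a * x) ^ (-(1 : ℝ) / (k : ℝ) - 1) =
      Real.cosh (a * x) ^ (-(1 : ℝ) / (k : ℝ) - 1 - 1) * Real.cosh (a * x) := by
    rw [Real.rpow_sub_one hC.ne' (-(1 : ℝ) / (k : ℝ) - 1), div_mul_cancel₀ _ hC.ne']
  have hgpow : Real.cosh (a * x) ^ ((2 * (k : ℝ) + 1) / (k : ℝ)) =
      (Real.cosh (a * x) ^ (-(1 : ℝ) / (k : ℝ) - 1 - 1))⁻¹ := by
    rw [← Real.rpow_neg hC.le]
    congr 1
    field_simp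
    ring
  have hP : 0 < Real.cosh (a * x) ^ (-(1 : ℝ) / (k : ℝ) - 1 - 1) := Real.rpow_pos_of_pos hC _
  have hsq := Real.cosh_sq (a * x)
  rw [deriv_deriv_fcomp ha.ne' hk.ne', deriv_fcomp ha.ne' hk.ne', gcomp, hgpow,
    Real.tanh_eq_sinh_div_cosh]
  simp only [hpow]
  generalize Real.cosh (a * x) ^ (-(1 : ℝ) / (k : ℝ) - 1 - 1) = P at hP ⊢
  generalize Real.cosh (a * x) = C at hC hsq ⊢
  generalize Real.sinh (a * x) = S at hS hsq ⊢
  have hA : S * (P * C) * (a * (C / S)) - a * ((k : ℝ) + 1 - C ^ 2) / k * P =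
      a * (k + 1) / k * S ^ 2 * P := by
    field_simp
    linear_combination (k + 1 : ℝ) * hsq
  rw [hA]
  refine ⟨by positivity, ?_, ?_⟩
  · have hratio : S * (P * C) * (a * (S / C)) / (a * (k + 1) / k * S ^ 2 * P) =
        (k : ℝ) / (k + 1) := by
      field_simp
    rw [hratio]
    field_simp
    ring
  · field_simp
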